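/- (Sub-Gaussian reward noise under dB-SNR errors, MGF form.) Let (Ω, ℱ, P) be a probability space, let ξ : Ω → ℝ be a measurable random variable, let σ > 0, and suppose that for every λ ∈ ℝ the moment generating function bound E[exp(λ·ξ)] ≤ exp(λ²σ²/2) holds (in particular exp(λξ) is integrable for all λ). Fix γ ≥ 0 and define η(ω) := log₂(1 + γ·10^{ξ(ω)/10}) − log₂(1 + γ). Then with L = (ln 10)/(10·ln 2), for every λ ∈ ℝ, exp(λ·η) is integrable and E[exp(λ·η)] ≤ 2·exp(λ²·L²·σ²/2). -/

import Mathlib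

open MeasureTheory

/-- The map `t ↦ log (1 + a * exp t)` is 1-Lipschitz at the origin. -/
lemma abs_log_one_add_mul_exp_sub_le {a : ℝ} (ha : 0 ≤ a) (t : ℝ) :
    |Real.log (1 + a * Real.exp t) - Real.log (1 + a)| ≤ |t| := by
  have hpos : 0 < 1 + a * Real.exp t := by positivity
  have ha' : 0 < 1 + a := by positivity
  have hone : (1 : ℝ) ≤ Real.exp |t| := Real.one_le_exp (abs_nonneg t)
  have hle : Real.exp t ≤ Real.exp |t| := Real.exp_le_exp.mpr (le_abs_self t)
  have hge : 1 ≤ Real.exp |t| * Real.exp t := by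
    rw [← Real.exp_add]
    exact Real.one_le_exp (by linarith [neg_abs_le t])
  have hupper : Real.log (1 + a * Real.exp t) ≤ |t| + Real.log (1 + a) := by
    rw [← Real.log_exp |t|, ← Real.log_mul (Real.exp_pos _).ne' ha'.ne']
    exact Real.log_le_log hpos (by nlinarith)
  have hlower : Real.log (1 + a) ≤ |t| + Real.log (1 + a * Real.exp t) := by
    rw [← Real.log_exp |t|, ← Real.log_mul (Real.exp_pos _).ne' hpos.ne']
    exact Real.log_le_log ha' (by nlinarith)
  rw [abs_le]
  constructor <;> linarith

/-- A decibel error `x` in the SNR shifts the rate by at most `log 10 / (10 * log 2) * |x|`. -/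
lemma abs_logb_one_add_mul_rpow_sub_le {a : ℝ} (ha : 0 ≤ a) (x : ℝ) :
    |Real.logb 2 (1 + a * (10 : ℝ) ^ (x / 10)) - Real.logb 2 (1 + a)| ≤
      Real.log 10 / (10 * Real.log 2) * |x| := by
  have h2 : 0 < Real.log 2 := Real.log_pos (by norm_num)
  have h10 : 0 < Real.log 10 := Real.log_pos (by norm_num)
  have h := abs_log_one_add_mul_exp_sub_le ha (Real.log 10 * (x / 10))
  rw [abs_mul, abs_div, abs_of_pos h10, abs_of_pos (by norm_num : (0 : ℝ) < 10)] at h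
  rw [Real.logb, Real.logb, ← sub_div, abs_div, abs_of_pos h2,
    Real.rpow_def_of_pos (by norm_num), div_le_iff₀ h2]
  calc _ ≤ _ := h
    _ = _ := by field_simp

/-- If `|y| ≤ |x|`, then `exp y ≤ exp x + exp (-x)`. -/
lemma exp_le_exp_add_exp_neg_of_abs_le {x y : ℝ} (h : |y| ≤ |x|) :
    Real.exp y ≤ Real.exp x + Real.exp (-x) := by
  have hy : Real.exp y ≤ Real.exp |x| := Real.exp_le_exp.mpr ((le_abs_self y).trans h)
  rcases abs_choice x with hx | hx <;> rw [hx] at hy <;>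
    linarith [Real.exp_pos x, Real.exp_pos (-x)]

/-- Sub-Gaussian reward noise under dB-SNR errors, MGF form:
if E[exp(λξ)] ≤ exp(λ²σ²/2) for every λ (with exp(λξ) integrable), then for
η = log₂(1 + γ·10^{ξ/10}) − log₂(1 + γ) and L = (ln 10)/(10·ln 2), for every λ,
exp(λη) is integrable and E[exp(λη)] ≤ 2·exp(λ²L²σ²/2). -/
theorem stmt4 {Ω : Type*} [MeasurableSpace Ω] (P : Measure Ω) [IsProbabilityMeasure P]
    (ξ : Ω → ℝ) (hξ : Measurable ξ) (σ : ℝ) (hσ : 0 < σ)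
    (hint : ∀ l : ℝ, Integrable (fun ω => Real.exp (l * ξ ω)) P)
    (hmgf : ∀ l : ℝ, ∫ ω, Real.exp (l * ξ ω) ∂P ≤ Real.exp (l ^ 2 * σ ^ 2 / 2))
    (γ : ℝ) (hγ : 0 ≤ γ) :
    ∀ l : ℝ,
      Integrable (fun ω =>
        Real.exp (l * (Real.logb 2 (1 + γ * (10 : ℝ) ^ (ξ ω / 10)) -
          Real.logb 2 (1 + γ)))) P ∧
      ∫ ω, Real.exp (l * (Real.logb 2 (1 + γ * (10 : ℝ) ^ (ξ ω / 10)) -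
          Real.logb 2 (1 + γ))) ∂P
        ≤ 2 * Real.exp (l ^ 2 * (Real.log 10 / (10 * Real.log 2)) ^ 2 * σ ^ 2 / 2) := by
  intro l
  set L := Real.log 10 / (10 * Real.log 2) with hL
  have hL0 : 0 ≤ L := by positivity
  have hbound : ∀ ω, Real.exp (l * (Real.logb 2 (1 + γ * (10 : ℝ) ^ (ξ ω / 10)) -
      Real.logb 2 (1 + γ))) ≤ Real.exp (l * L * ξ ω) + Real.exp (-(l * L) * ξ ω) := by
    intro ω
    rw [neg_mul]
    apply exp_le_exp_add_exp_neg_of_abs_le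
    rw [abs_mul, mul_assoc, abs_mul l, abs_mul L, abs_of_nonneg hL0]
    gcongr
    exact abs_logb_one_add_mul_rpow_sub_le hγ (ξ ω)
  have hdom := (hint (l * L)).add (hint (-(l * L)))
  have hmeas : Measurable fun ω => Real.exp (l * (Real.logb 2 (1 + γ * (10 : ℝ) ^ (ξ ω / 10)) -
      Real.logb 2 (1 + γ))) := by
    simp only [Real.logb]
    fun_prop
  have hη := hdom.mono' hmeas.aestronglyMeasurable
    (ae_of_all _ fun ω => by
      rw [Real.norm_eq_abs, Real.abs_exp]
      exact hbound ω)
  refine ⟨hη, (integral_mono hη hdom hbound).trans ?_⟩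
  rw [integral_add' (hint _) (hint _)]
  have hpos := hmgf (l * L)
  have hneg := hmgf (-(l * L))
  rw [neg_sq] at hneg
  rw [mul_pow] at hpos hneg
  linarith
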